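/- Let n ≥ 3 and let x be an integer with 1 < x < n. If n ≡ 2 (mod 3), x ≡ 1 (mod 3), and 2x < n, then the 5-regular circulant graph C_{2n}(x,1,n) is word-representable. -/

import Mathlib

/-- Two letters `x` and `y` alternate in the word `w` if, after deleting all letters
other than `x` and `y`, no two consecutive letters of the resulting word are equal. -/
def Alternate {V : Type*} [DecidableEq V] (w : List V) (x y : V) : Prop :=
  (w.filter (fun z => decide (z = x ∨ z = y))).Chain' (· ≠ ·)

/-- A word `w` represents the graph `G` if it contains every vertex at least once and
two distinct vertices are adjacent in `G` iff they alternate in `w`. -/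
def Represents {V : Type*} [DecidableEq V] (G : SimpleGraph V) (w : List V) : Prop :=
  (∀ v : V, v ∈ w) ∧ ∀ x y : V, x ≠ y → (G.Adj x y ↔ Alternate w x y)

/-- A graph is word-representable if some word represents it. -/
def WordRepresentable {V : Type*} [DecidableEq V] (G : SimpleGraph V) : Prop :=
  ∃ w : List V, Represents G w

/-- A word is `k`-uniform if every letter of the alphabet occurs in it exactly `k` times. -/
def IsKUniform {V : Type*} [DecidableEq V] (w : List V) (k : ℕ) : Prop :=
  ∀ v : V, w.count v = k

theorem isChain_flatten_replicate_pair {V : Type*} {u v : V} (h : u ≠ v) (k : ℕ) :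
    ((List.replicate k [u, v]).flatten).IsChain (· ≠ ·) := by
  induction k with
  | zero => simp
  | succ k ih =>
    cases k with
    | zero => simpa using h
    | succ k =>
      simp only [List.replicate_succ, List.flatten_cons, List.cons_append, List.nil_append,
        List.isChain_cons_cons] at ih ⊢
      exact ⟨h, h.symm, ih⟩

section WordsFromColorings

variable {V : Type*} [DecidableEq V]

/-- The concatenation of the sublists of `L` cut out by the predicates in `ps`. -/
def blockWord (L : List V) (ps : List (V → Bool)) : List V :=
  ps.flatMap fun p => L.filter p

theorem filter_pair_filter {L : List V} (hL : L.Nodup) (hmem : ∀ v, v ∈ L) {u v : V}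
    (p : V → Bool) (h : ¬ (p u = true ∧ p v = true)) :
    (L.filter p).filter (fun z => decide (z = u ∨ z = v)) =
      if p u then [u] else if p v then [v] else [] := by
  have single : ∀ a : V, L.filter (fun z => decide (z = a)) = [a] := fun a => by
    rw [List.filter_congr (q := (· == a)) fun z _ => (beq_eq_decide z a).symm, List.filter_beq,
      List.count_eq_one_of_mem hL (hmem a), List.replicate_one]
  rw [List.filter_filter]
  split_ifs with hu hv
  · rw [← single u]
    exact List.filter_congr fun z _ => by grind
  · rw [← single v]
    exact List.filter_congr fun z _ => by grind
  · rw [List.filter_eq_nil_iff]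
    grind

theorem filter_pair_blockWord {L : List V} (hL : L.Nodup) (hmem : ∀ v, v ∈ L) {u v : V}
    (ps : List (V → Bool)) (h : ∀ p ∈ ps, ¬ (p u = true ∧ p v = true)) :
    (blockWord L ps).filter (fun z => decide (z = u ∨ z = v)) =
      ps.flatMap fun p => if p u then [u] else if p v then [v] else [] := by
  induction ps with
  | nil => rfl
  | cons p ps ih =>
    simp only [blockWord, List.flatMap_cons, List.filter_append] at ih ⊢
    rw [filter_pair_filter hL hmem p (h p (by simp)), ih fun q hq => h q (by simp [hq])]

/-- Along every edge `u v` with `f u < f v`, the word restricted to `u, v` is a power of `uv`. -/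
def RespectsEdges (G : SimpleGraph V) (f : V → ℕ) (w : List V) : Prop :=
  ∀ u v, G.Adj u v → f u < f v →
    ∃ k, w.filter (fun z => decide (z = u ∨ z = v)) = (List.replicate k [u, v]).flatten

theorem RespectsEdges.append {G : SimpleGraph V} {f : V → ℕ} {w w' : List V}
    (h : RespectsEdges G f w) (h' : RespectsEdges G f w') : RespectsEdges G f (w ++ w') := by
  intro u v huv hlt
  obtain ⟨k, hk⟩ := h u v huv hlt
  obtain ⟨l, hl⟩ := h' u v huv hlt
  exact ⟨k + l, by rw [List.filter_append, hk, hl, List.replicate_add, List.flatten_append]⟩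

theorem RespectsEdges.flatMap {ι : Type*} {G : SimpleGraph V} {f : V → ℕ} {w : ι → List V}
    (l : List ι) (h : ∀ i ∈ l, RespectsEdges G f (w i)) : RespectsEdges G f (l.flatMap w) := by
  induction l with
  | nil => exact fun u v _ _ => ⟨0, rfl⟩
  | cons i l ih =>
    exact (h i (by simp)).append (ih fun j hj => h j (by simp [hj]))

theorem alternate_iff_isChain {w : List V} {u v : V} :
    Alternate w u v ↔ (w.filter fun z => decide (z = u ∨ z = v)).IsChain (· ≠ ·) :=
  Iff.rfl

theorem Alternate.symm {w : List V} {u v : V} (h : Alternate w u v) : Alternate w v u := by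
  simpa only [Alternate, or_comm] using h

theorem Alternate.of_infix {w w' : List V} {u v : V} (h : Alternate w u v) (hw : w' <:+: w) :
    Alternate w' u v :=
  List.IsChain.infix h (hw.filter _)

theorem RespectsEdges.alternate {G : SimpleGraph V} {f : V → ℕ} {w : List V}
    (h : RespectsEdges G f w) (hf : ∀ u v, G.Adj u v → f u ≠ f v) {u v : V} (huv : G.Adj u v) :
    Alternate w u v := by
  rcases lt_or_gt_of_ne (hf u v huv) with hlt | hlt
  · obtain ⟨k, hk⟩ := h u v huv hlt
    rw [alternate_iff_isChain, hk]
    exact isChain_flatten_replicate_pair huv.ne k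
  · obtain ⟨k, hk⟩ := h v u huv.symm hlt
    refine Alternate.symm ?_
    rw [alternate_iff_isChain, hk]
    exact isChain_flatten_replicate_pair huv.ne' k

theorem wordRepresentable_of_separating_words [Fintype V] {G : SimpleGraph V} {f : V → ℕ}
    (hf : ∀ u v, G.Adj u v → f u ≠ f v) {w₀ : List V} (h₀ : RespectsEdges G f w₀)
    (hmem : ∀ v, v ∈ w₀)
    (hsep : ∀ u v, u ≠ v → ¬ G.Adj u v → ∃ w, RespectsEdges G f w ∧ ¬ Alternate w u v) :
    WordRepresentable G := by
  have hsep' : ∀ q : V × V, ∃ w, RespectsEdges G f w ∧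
      (q.1 ≠ q.2 → ¬ G.Adj q.1 q.2 → ¬ Alternate w q.1 q.2) := by
    intro q
    by_cases hq : q.1 ≠ q.2 ∧ ¬ G.Adj q.1 q.2
    · obtain ⟨w, hw, hw'⟩ := hsep _ _ hq.1 hq.2
      exact ⟨w, hw, fun _ _ => hw'⟩
    · exact ⟨w₀, h₀, fun h h' => absurd ⟨h, h'⟩ hq⟩
  choose w hw hw' using hsep'
  have hall : RespectsEdges G f (w₀ ++ (Finset.univ : Finset (V × V)).toList.flatMap w) :=
    h₀.append (RespectsEdges.flatMap _ fun q _ => hw q)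
  refine ⟨_, fun v => List.mem_append_left _ (hmem v), fun u v huv =>
    ⟨fun hadj => hall.alternate hf hadj, fun halt => ?_⟩⟩
  by_contra hadj
  refine hw' (u, v) huv hadj (halt.of_infix ?_)
  refine List.IsInfix.trans ?_ (List.suffix_append _ _).isInfix
  exact List.infix_of_mem_flatten
    (List.mem_map_of_mem (Finset.mem_toList.2 (Finset.mem_univ (u, v))))

theorem respectsEdges_blockWord {G : SimpleGraph V} {f : V → ℕ} {L : List V} (hL : L.Nodup)
    (hmem : ∀ v, v ∈ L) (ps : List (V → Bool))
    (h : ∀ u v, G.Adj u v → f u < f v → (∀ p ∈ ps, ¬ (p u = true ∧ p v = true)) ∧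
      ∃ k, (ps.flatMap fun p => if p u then [u] else if p v then [v] else []) =
        (List.replicate k [u, v]).flatten) :
    RespectsEdges G f (blockWord L ps) := by
  intro u v huv hlt
  obtain ⟨hps, k, hk⟩ := h u v huv hlt
  exact ⟨k, by rw [filter_pair_blockWord hL hmem ps hps, hk]⟩

theorem lt_cases_of_lt_three {i j : ℕ} (hij : i < j) (hj : j < 3) :
    (i = 0 ∧ j = 1) ∨ (i = 0 ∧ j = 2) ∨ (i = 1 ∧ j = 2) := by
  lia

theorem exists_separating_word [Fintype V] {G : SimpleGraph V} {f : V → ℕ} (hf3 : ∀ v, f v < 3)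
    {u v : V} (hne : u ≠ v) (hadj : ¬ G.Adj u v) (hle : f u ≤ f v) :
    ∃ w, RespectsEdges G f w ∧ ¬ Alternate w u v := by
  set L := (Finset.univ : Finset V).toList
  have hL : L.Nodup := Finset.nodup_toList _
  have hmem : ∀ v, v ∈ L := by simp [L]
  have hu := hf3 u
  have hv := hf3 v
  have hcases : f u = f v ∨ (f u = 0 ∧ f v = 1) ∨ (f u = 1 ∧ f v = 2) ∨ (f u = 0 ∧ f v = 2) := by
    lia
  rcases hcases with heq | ⟨h0, h1⟩ | ⟨h1, h2⟩ | ⟨h0, h2⟩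
  · refine ⟨blockWord L [fun z => f z = 0 ∧ z = u, fun z => f z = 0 ∧ z ≠ u,
      fun z => f z = 1 ∧ z = u, fun z => f z = 1 ∧ z ≠ u,
      fun z => f z = 2 ∧ z = u, fun z => f z = 2 ∧ z ≠ u,
      fun z => f z = 0 ∧ z ≠ u, fun z => f z = 0 ∧ z = u,
      fun z => f z = 1 ∧ z ≠ u, fun z => f z = 1 ∧ z = u,
      fun z => f z = 2 ∧ z ≠ u, fun z => f z = 2 ∧ z = u], ?_, ?_⟩
    · refine respectsEdges_blockWord hL hmem _ fun a b hab hlt => ?_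
      have hne' := hab.ne
      by_cases hau : a = u <;> by_cases hbu : b = u <;>
        rcases lt_cases_of_lt_three hlt (hf3 b) with ⟨ha, hb⟩ | ⟨ha, hb⟩ | ⟨ha, hb⟩ <;>
        refine ⟨by simp_all, 2, by simp_all [List.replicate]⟩
    · rw [alternate_iff_isChain, filter_pair_blockWord hL hmem _ (by simp_all [hne.symm])]
      rcases (by lia : f v = 0 ∨ f v = 1 ∨ f v = 2) with h | h | h <;> simp [heq, h, hne.symm]
  · refine ⟨blockWord L [fun z => f z = 0, fun z => f z = 1, fun z => f z = 2,
      fun z => f z = 0 ∧ z ≠ u, fun z => z = v, fun z => z = u,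
      fun z => f z = 1 ∧ z ≠ v, fun z => f z = 2], ?_, ?_⟩
    · refine respectsEdges_blockWord hL hmem _ fun a b hab hlt => ?_
      have hne' := hab.ne
      have hnot : ¬ (a = u ∧ b = v) := by rintro ⟨rfl, rfl⟩; exact hadj hab
      by_cases hau : a = u <;> by_cases hbu : b = u <;> by_cases hav : a = v <;>
        by_cases hbv : b = v <;>
        rcases lt_cases_of_lt_three hlt (hf3 b) with ⟨ha, hb⟩ | ⟨ha, hb⟩ | ⟨ha, hb⟩ <;>
        refine ⟨by simp_all, 2, by simp_all [List.replicate]⟩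
    · rw [alternate_iff_isChain, filter_pair_blockWord hL hmem _ (by simp_all [hne.symm])]
      simp [h0, h1, hne, hne.symm]
  · refine ⟨blockWord L [fun z => f z = 0, fun z => f z = 1, fun z => f z = 2,
      fun z => f z = 0, fun z => f z = 1 ∧ z ≠ u, fun z => z = v, fun z => z = u,
      fun z => f z = 2 ∧ z ≠ v], ?_, ?_⟩
    · refine respectsEdges_blockWord hL hmem _ fun a b hab hlt => ?_
      have hne' := hab.ne
      have hnot : ¬ (a = u ∧ b = v) := by rintro ⟨rfl, rfl⟩; exact hadj hab
      by_cases hau : a = u <;> by_cases hbu : b = u <;> by_cases hav : a = v <;>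
        by_cases hbv : b = v <;>
        rcases lt_cases_of_lt_three hlt (hf3 b) with ⟨ha, hb⟩ | ⟨ha, hb⟩ | ⟨ha, hb⟩ <;>
        refine ⟨by simp_all, 2, by simp_all [List.replicate]⟩
    · rw [alternate_iff_isChain, filter_pair_blockWord hL hmem _ (by simp_all [hne.symm])]
      simp [h1, h2, hne, hne.symm]
  · refine ⟨blockWord L [fun z => f z = 0, fun z => f z = 1, fun z => f z = 2 ∧ z ≠ v,
      fun z => z = u, fun z => z = v, fun z => f z = 0 ∧ z ≠ u, fun z => f z = 1,
      fun z => f z = 2], ?_, ?_⟩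
    · refine respectsEdges_blockWord hL hmem _ fun a b hab hlt => ?_
      have hne' := hab.ne
      have hnot : ¬ (a = u ∧ b = v) := by rintro ⟨rfl, rfl⟩; exact hadj hab
      by_cases hau : a = u <;> by_cases hbu : b = u <;> by_cases hav : a = v <;>
        by_cases hbv : b = v <;>
        rcases lt_cases_of_lt_three hlt (hf3 b) with ⟨ha, hb⟩ | ⟨ha, hb⟩ | ⟨ha, hb⟩ <;>
        refine ⟨by simp_all, 2, by simp_all [List.replicate]⟩
    · rw [alternate_iff_isChain, filter_pair_blockWord hL hmem _ (by simp_all [hne.symm])]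
      simp [h0, h2, hne, hne.symm]

/-- Every 3-colorable finite graph is word-representable. -/
theorem wordRepresentable_of_colorable_three [Fintype V] {G : SimpleGraph V}
    (hG : G.Colorable 3) : WordRepresentable G := by
  obtain ⟨C⟩ := hG
  set f : V → ℕ := fun v => (C v : ℕ)
  have hf3 : ∀ v, f v < 3 := fun v => (C v).isLt
  have hf : ∀ u v, G.Adj u v → f u ≠ f v := fun u v huv h => C.valid huv (Fin.ext h)
  set L := (Finset.univ : Finset V).toList
  have hL : L.Nodup := Finset.nodup_toList _
  have hmem : ∀ v, v ∈ L := by simp [L]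
  refine wordRepresentable_of_separating_words hf
    (w₀ := blockWord L [fun z => f z = 0, fun z => f z = 1, fun z => f z = 2]) ?_ ?_ ?_
  · refine respectsEdges_blockWord hL hmem _ fun a b hab hlt => ?_
    rcases lt_cases_of_lt_three hlt (hf3 b) with ⟨ha, hb⟩ | ⟨ha, hb⟩ | ⟨ha, hb⟩ <;>
      refine ⟨by simp [ha, hb], 1, by simp [ha, hb]⟩
  · intro v
    have hv := hf3 v
    simp only [blockWord, List.flatMap_cons, List.flatMap_nil, List.mem_append, List.mem_filter,
      hmem v, true_and, decide_eq_true_eq, List.not_mem_nil, or_false]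
    lia
  · intro u v hne hadj
    rcases le_total (f u) (f v) with hle | hle
    · exact exists_separating_word hf3 hne hadj hle
    · obtain ⟨w, hw, hw'⟩ := exists_separating_word hf3 hne.symm (fun h => hadj h.symm) hle
      exact ⟨w, hw, fun h => hw' h.symm⟩

end WordsFromColorings

/-- If `3 ∣ m + k`, the map `i ↦ i + ⌊k i / m⌋` modulo `3` colors a circulant graph on `ℤ/m`
properly as soon as each jump `s` has `k s / m ∈ [l, l + 1]` with `s + l ≡ 1 (mod 3)`. -/
theorem circulantGraph_colorable_three {m k : ℕ} (hm : 0 < m) (hmk : 3 ∣ m + k)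
    (S : Set (ZMod m))
    (hS : ∀ a ∈ S, ∃ s l : ℕ, a = (s : ZMod m) ∧ l * m ≤ k * s ∧ k * s ≤ (l + 1) * m ∧
      (s + l) % 3 = 1) :
    (SimpleGraph.circulantGraph S).Colorable 3 := by
  have : NeZero m := ⟨hm.ne'⟩
  set g : ℕ → ℕ := fun i => i + k * i / m with hg
  have hper : ∀ i, g (i % m) % 3 = g i % 3 := by
    intro i
    obtain ⟨c, hc⟩ := hmk
    have hsum : g i = g (i % m) + 3 * (c * (i / m)) := by
      have hdiv : k * i / m = k * (i % m) / m + k * (i / m) := by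
        rw [← Nat.add_mul_div_right _ _ hm]
        congr 1
        conv_lhs => rw [← Nat.mod_add_div i m]
        ring
      have hi := Nat.mod_add_div i m
      have hck : m * (i / m) + k * (i / m) = 3 * (c * (i / m)) := by
        rw [← add_mul, hc, mul_assoc]
      simp only [hg]
      lia
    rw [hsum, Nat.add_mul_mod_self_left]
  have hstep : ∀ a b : ZMod m, b - a ∈ S → g a.val % 3 ≠ g b.val % 3 := by
    intro a b hab
    obtain ⟨s, l, hs, hlo, hhi, hsl⟩ := hS _ hab
    have hb : b.val = (a.val + s) % m := by
      rw [← ZMod.val_natCast]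
      congr 1
      push_cast
      rw [ZMod.natCast_zmod_val, ← hs]
      ring
    rw [hb, hper]
    have h1 : k * a.val / m + l ≤ k * (a.val + s) / m := by
      rw [← Nat.add_mul_div_right _ _ hm]
      exact Nat.div_le_div_right (by rw [mul_add]; lia)
    have h2 : k * (a.val + s) / m ≤ k * a.val / m + (l + 1) := by
      rw [← Nat.add_mul_div_right _ _ hm]
      exact Nat.div_le_div_right (by rw [mul_add]; lia)
    simp only [hg]
    lia
  refine ⟨SimpleGraph.Coloring.mk (fun v => ⟨g v.val % 3, Nat.mod_lt _ (by norm_num)⟩) ?_⟩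
  intro a b hab heq
  have heq' : g a.val % 3 = g b.val % 3 := Fin.mk.inj_iff.1 heq
  rw [SimpleGraph.circulantGraph, SimpleGraph.fromRel_adj] at hab
  rcases hab.2 with h | h
  · exact hstep b a h heq'.symm
  · exact hstep a b h heq'

theorem exists_slope_parameter {n x : ℕ} (hx1 : 1 < x) (h0 : n % 3 = 2) (h1 : x % 3 = 1)
    (h2 : 2 * x < n) :
    ∃ t : ℕ, 12 * t + 5 ≤ 2 * n ∧ 3 * t * (2 * n) ≤ (12 * t + 5) * x ∧
      (12 * t + 5) * x ≤ (3 * t + 1) * (2 * n) := by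
  obtain ⟨d, rfl⟩ := Nat.exists_eq_add_of_lt h2
  obtain ⟨e, rfl⟩ : ∃ e, d = e + 2 := ⟨d - 2, by lia⟩
  rcases lt_or_ge x (e + 3) with hlt | hle
  · exact ⟨0, by lia, by lia, by lia⟩
  · have hup := Nat.div_mul_le_self (x + 4 * (e + 3)) (6 * (e + 3))
    have hlo := Nat.lt_div_mul_add (a := x + 4 * (e + 3)) (b := 6 * (e + 3)) (by lia)
    set t := (x + 4 * (e + 3)) / (6 * (e + 3))
    refine ⟨t, ?_, ?_, ?_⟩ <;> nlinarith

theorem stmt10 (n x : ℕ) (hn : 3 ≤ n) (hx1 : 1 < x) (hxn : x < n)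
    (h0 : n % 3 = 2) (h1 : x % 3 = 1) (h2 : 2*x < n) :
    WordRepresentable (SimpleGraph.circulantGraph {((1 : ℕ) : ZMod (2*n)), ((x : ℕ) : ZMod (2*n)), ((n : ℕ) : ZMod (2*n))}) := by
  have : NeZero (2 * n) := ⟨by lia⟩
  obtain ⟨t, ht, hlo, hhi⟩ := exists_slope_parameter hx1 h0 h1 h2
  refine wordRepresentable_of_colorable_three
    (circulantGraph_colorable_three (k := 12 * t + 5) (by lia) (by lia) _ ?_)
  rintro a (rfl | rfl | rfl)
  · exact ⟨1, 0, rfl, by lia, by lia, by lia⟩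
  · exact ⟨x, 3 * t, rfl, hlo, hhi, by lia⟩
  · exact ⟨n, 6 * t + 2, rfl, by nlinarith, by nlinarith, by lia⟩
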